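/- arXiv:2208.11413 — 3 statements merged into one kernel-verified Lean document; each statement's English description precedes it below -/
import Mathlib

section
/- Let n ≥ 2, r ∈ (0, π/4), and let a, z, p ∈ Sⁿ. If ∫_{B_{p,r}} g(z·F_a(v)) π_z(F_a(v)) dv = 0 (a vector-valued integral in ℝ^{n+1}), then p lies in the two-dimensional linear span of a and z in ℝ^{n+1}. -/
open MeasureTheory Real
open scoped RealInnerProductSpace

noncomputable section

/-- The unit sphere `Sⁿ ⊆ ℝ^{n+1}`. -/
def sph (n : ℕ) : Set (EuclideanSpace ℝ (Fin (n + 1))) := Metric.sphere 0 1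

/-- Reflection `R_a(z) = z - 2(z·a)a` across the hyperplane `a^⊥`. -/
def sphRefl (n : ℕ) (a z : EuclideanSpace ℝ (Fin (n + 1))) : EuclideanSpace ℝ (Fin (n + 1)) :=
  z - (2 * ⟪z, a⟫) • a

/-- The folding map `F_a` : reflect the open half-sphere `{z·a > 0}` onto `{z·a < 0}`. -/
def fold (n : ℕ) (a z : EuclideanSpace ℝ (Fin (n + 1))) : EuclideanSpace ℝ (Fin (n + 1)) :=
  if 0 < ⟪z, a⟫ then sphRefl n a z else z

/-- Projection `π_z(w) = w - (w·z)z` onto the tangent space `z^⊥`. -/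
def proj (n : ℕ) (z w : EuclideanSpace ℝ (Fin (n + 1))) : EuclideanSpace ℝ (Fin (n + 1)) :=
  w - ⟪w, z⟫ • z

/-- The open geodesic ball `B_{p,r}` on the unit sphere: points of the sphere at geodesic
(angular) distance `arccos (p·v) < r` from `p`. -/
def gball (n : ℕ) (p : EuclideanSpace ℝ (Fin (n + 1))) (r : ℝ) :
    Set (EuclideanSpace ℝ (Fin (n + 1))) :=
  {v | v ∈ sph n ∧ Real.arccos ⟪p, v⟫ < r}

/-- `G(t) = ∫₀ᵗ g(s) ds`. -/
def Gfun (g : ℝ → ℝ) (t : ℝ) : ℝ := ∫ s in (0:ℝ)..t, g s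


theorem hemi_fin (n : ℕ) (v : EuclideanSpace ℝ (Fin (n + 1))) (hv : ‖v‖ = 1) :
    (μH[(n:ℝ)] : Measure (EuclideanSpace ℝ (Fin (n + 1)))) {x | x ∈ sph n ∧ ⟪v, x⟫ ≤ 0} < ⊤ := by
  have hv0 : v ≠ 0 := by rintro rfl; simp at hv
  haveI : Fact (Module.finrank ℝ (EuclideanSpace ℝ (Fin (n + 1))) = n + 1) := ⟨by simp⟩
  have hfr : Module.finrank ℝ (ℝ ∙ v)ᗮ = n := Submodule.finrank_orthogonal_span_singleton hv0
  set f : (ℝ ∙ v)ᗮ → EuclideanSpace ℝ (Fin (n + 1)) := fun w => stereoInvFunAux v (w : EuclideanSpace ℝ (Fin (n + 1))) with hf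
  have hfc : ContDiff ℝ 1 f :=
    (contDiff_stereoInvFunAux (v := v)).comp (ℝ ∙ v)ᗮ.subtypeL.contDiff
  have hK : IsCompact (Metric.closedBall (0 : (ℝ ∙ v)ᗮ) 2) := isCompact_closedBall _ _
  obtain ⟨C, hC⟩ := hfc.contDiffOn.exists_lipschitzOnWith one_ne_zero
    (convex_closedBall (0 : (ℝ ∙ v)ᗮ) 2) hK
  have h1 := hC.hausdorffMeasure_image_le (d := (n:ℝ)) (by positivity)
  have h2 : (μH[(n:ℝ)] : Measure (ℝ ∙ v)ᗮ) (Metric.closedBall (0 : (ℝ ∙ v)ᗮ) 2) < ⊤ := by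
    have := isAddHaarMeasure_hausdorffMeasure (E := (ℝ ∙ v)ᗮ)
    rw [hfr] at this
    exact hK.measure_lt_top
  refine lt_of_le_of_lt (measure_mono ?_) (lt_of_le_of_lt h1 ?_)
  · rintro x ⟨hx, hx0⟩
    have hxn : ‖x‖ = 1 := by simpa [sph] using hx
    have hxv : x ≠ v := by
      rintro rfl
      rw [real_inner_self_eq_norm_sq, hxn] at hx0
      norm_num at hx0
    refine ⟨stereoToFun v x, ?_, ?_⟩
    · rw [mem_closedBall_zero_iff, stereoToFun_apply, norm_smul]
      have ha : ‖(ℝ ∙ v)ᗮ.orthogonalProjectionOnto x‖ ≤ 1 := by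
        rw [← hxn]; exact Submodule.norm_orthogonalProjectionOnto_apply_le _ _
      have hb : ‖2 / ((1:ℝ) - innerSL ℝ v x)‖ ≤ 2 := by
        rw [innerSL_apply_apply, Real.norm_eq_abs, abs_of_nonneg (by apply div_nonneg <;> linarith),
          div_le_iff₀ (by linarith)]
        linarith
      calc _ ≤ (2:ℝ) * 1 := mul_le_mul hb ha (norm_nonneg _) (by norm_num)
        _ = 2 := by norm_num
    · have := stereo_left_inv hv (x := ⟨x, hx⟩) hxv
      exact congrArg Subtype.val this
  · exact ENNReal.mul_lt_top (ENNReal.rpow_lt_top_of_nonneg (by positivity) (by simp)) h2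

theorem sph_fin (n : ℕ) :
    (μH[(n:ℝ)] : Measure (EuclideanSpace ℝ (Fin (n + 1)))) (sph n) < ⊤ := by
  obtain ⟨v, hv⟩ := exists_norm_eq (EuclideanSpace ℝ (Fin (n + 1))) (zero_le_one' ℝ)
  refine lt_of_le_of_lt (measure_mono (t := {x | x ∈ sph n ∧ ⟪v, x⟫ ≤ 0} ∪ {x | x ∈ sph n ∧ ⟪-v, x⟫ ≤ 0}) ?_)
    (measure_union_lt_top (hemi_fin n v hv) (hemi_fin n (-v) (by simpa using hv)))
  intro x hx
  rcases le_total ⟪v, x⟫ 0 with h | h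
  · exact Or.inl ⟨hx, h⟩
  · exact Or.inr ⟨hx, by simpa [inner_neg_left] using h⟩

theorem sph_open_pos (n : ℕ) (U : Set (EuclideanSpace ℝ (Fin (n + 1)))) (hU : IsOpen U)
    (v : EuclideanSpace ℝ (Fin (n + 1))) (hvU : v ∈ U) (hvs : v ∈ sph n) :
    0 < (μH[(n:ℝ)] : Measure (EuclideanSpace ℝ (Fin (n + 1)))) (U ∩ sph n) := by
  have hv : ‖v‖ = 1 := by simpa [sph] using hvs
  have hv0 : v ≠ 0 := by rintro rfl; simp at hv
  haveI : Fact (Module.finrank ℝ (EuclideanSpace ℝ (Fin (n + 1))) = n + 1) := ⟨by simp⟩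
  have hfr : Module.finrank ℝ (ℝ ∙ v)ᗮ = n := Submodule.finrank_orthogonal_span_singleton hv0
  have hH := isAddHaarMeasure_hausdorffMeasure (E := (ℝ ∙ v)ᗮ)
  rw [hfr] at hH
  set f : (ℝ ∙ v)ᗮ → EuclideanSpace ℝ (Fin (n + 1)) := fun y => (y : EuclideanSpace ℝ (Fin (n + 1))) + Real.sqrt (1 - ‖y‖ ^ 2) • v with hf
  have hfc : Continuous f := by fun_prop
  have hV : IsOpen (f ⁻¹' U ∩ Metric.ball 0 1) := (hU.preimage hfc).inter Metric.isOpen_ball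
  have hpos : 0 < (μH[(n:ℝ)] : Measure (ℝ ∙ v)ᗮ) (f ⁻¹' U ∩ Metric.ball 0 1) :=
    hV.measure_pos _ ⟨0, by simpa [hf] using hvU, by simp⟩
  have hP : LipschitzWith 1 ((ℝ ∙ v)ᗮ.orthogonalProjectionOnto) :=
    Submodule.lipschitzWith_orthogonalProjectionOnto _
  have h1 := hP.hausdorffMeasure_image_le (d := (n:ℝ)) (by positivity) (U ∩ sph n)
  rw [ENNReal.coe_one, ENNReal.one_rpow, one_mul] at h1
  refine lt_of_lt_of_le (lt_of_lt_of_le hpos (measure_mono ?_)) h1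
  rintro y ⟨hy, hy1⟩
  rw [mem_ball_zero_iff] at hy1
  have hyv : ⟪(y : EuclideanSpace ℝ (Fin (n + 1))), v⟫ = 0 :=
    Submodule.mem_orthogonal_singleton_iff_inner_left.1 y.2
  refine ⟨f y, ⟨hy, ?_⟩, ?_⟩
  · have : ‖f y‖ ^ 2 = 1 := by
      rw [hf]
      simp only
      rw [norm_add_sq_real, norm_smul, inner_smul_right, hyv, hv, Real.norm_eq_abs, mul_one, sq_abs,
        Real.sq_sqrt (by nlinarith [norm_nonneg y])]
      simp
    simp only [sph, mem_sphere_zero_iff_norm]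
    nlinarith [norm_nonneg (f y)]
  · rw [hf]
    simp only [map_add, map_smul]
    rw [Submodule.orthogonalProjectionOnto_orthogonalComplement_singleton_eq_zero]
    simp

theorem gball_iff (n : ℕ) (p : EuclideanSpace ℝ (Fin (n + 1))) (hp : p ∈ sph n) (r : ℝ)
    (hr : r ∈ Set.Ioo 0 (π / 4)) (v : EuclideanSpace ℝ (Fin (n + 1))) :
    v ∈ gball n p r ↔ v ∈ sph n ∧ Real.cos r < ⟪p, v⟫ := by
  unfold gball
  simp only [Set.mem_setOf_eq]
  refine and_congr_right fun hv => ?_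
  have hpn : ‖p‖ = 1 := by simpa [sph] using hp
  have hvn : ‖v‖ = 1 := by simpa [sph] using hv
  have h := abs_real_inner_le_norm p v
  rw [hpn, hvn, mul_one, abs_le] at h
  have h0 := Real.arccos_nonneg ⟪p, v⟫
  have hpi := Real.arccos_le_pi ⟪p, v⟫
  have hc := Real.cos_arccos h.1 h.2
  have := Real.strictAntiOn_cos.lt_iff_gt (a := r) (b := Real.arccos ⟪p, v⟫)
    ⟨hr.1.le, by linarith [hr.2, Real.pi_pos]⟩ ⟨h0, hpi⟩
  rw [hc] at this
  exact this.symm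

theorem norm_fold (n : ℕ) (a v : EuclideanSpace ℝ (Fin (n + 1))) (ha : ‖a‖ = 1) :
    ‖fold n a v‖ = ‖v‖ := by
  unfold fold sphRefl
  split_ifs
  · have : ‖v - (2 * ⟪v, a⟫) • a‖ ^ 2 = ‖v‖ ^ 2 := by
      rw [norm_sub_sq_real, norm_smul, inner_smul_right, ha, Real.norm_eq_abs, mul_one, sq_abs]
      ring
    exact (sq_eq_sq₀ (norm_nonneg _) (norm_nonneg _)).1 this
  · rfl

theorem measurable_fold (n : ℕ) (a : EuclideanSpace ℝ (Fin (n + 1))) :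
    Measurable (fold n a) := by
  unfold fold sphRefl
  refine Measurable.ite ?_ ?_ measurable_id
  · exact (isOpen_lt continuous_const (by fun_prop)).measurableSet
  · exact Continuous.measurable (by fun_prop)

/-- reflection fixing everything orthogonal to `u` -/
theorem exists_refl (n : ℕ) (u : EuclideanSpace ℝ (Fin (n + 1))) (hu : ‖u‖ = 1) :
    ∃ ρ : EuclideanSpace ℝ (Fin (n + 1)) ≃ₗᵢ[ℝ] EuclideanSpace ℝ (Fin (n + 1)),
      ∀ v, ρ v = v - (2 * ⟪u, v⟫) • u := by
  refine ⟨(ℝ ∙ u)ᗮ.reflection, fun v => ?_⟩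
  rw [Submodule.reflection_orthogonal_apply, Submodule.reflection_singleton_apply, hu]
  simp [mul_smul, two_smul]

theorem inner_fold_refl (n : ℕ) (a z u v : EuclideanSpace ℝ (Fin (n + 1)))
    (hua : ⟪u, a⟫ = 0) (huz : ⟪u, z⟫ = 0) (c : ℝ) :
    ⟪z, fold n a (v - c • u)⟫ = ⟪z, fold n a v⟫ := by
  have h1 : ⟪v - c • u, a⟫ = ⟪v, a⟫ := by
    rw [inner_sub_left, real_inner_smul_left, hua]; ring
  have h2 : ⟪z, u⟫ = 0 := by rw [real_inner_comm]; exact huz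
  unfold fold sphRefl
  rw [h1]
  split_ifs
  · simp only [inner_sub_right, real_inner_smul_right, h2]; ring
  · simp only [inner_sub_right, real_inner_smul_right, h2]; ring

theorem inner_u_fold (n : ℕ) (a u v : EuclideanSpace ℝ (Fin (n + 1)))
    (hua : ⟪u, a⟫ = 0) : ⟪u, fold n a v⟫ = ⟪u, v⟫ := by
  unfold fold sphRefl
  split_ifs
  · simp only [inner_sub_right, real_inner_smul_right, hua]; ring
  · rfl

theorem inner_lt (n : ℕ) (z u w : EuclideanSpace ℝ (Fin (n + 1))) (hz : ‖z‖ = 1)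
    (hw : ‖w‖ = 1) (huz : ⟪u, z⟫ = 0) (huw : ⟪u, w⟫ ≠ 0) : ⟪z, w⟫ ∈ Set.Ioo (-1:ℝ) 1 := by
  have h := abs_real_inner_le_norm z w
  rw [hz, hw, mul_one, abs_le] at h
  refine ⟨lt_of_le_of_ne h.1 fun he => huw ?_, lt_of_le_of_ne h.2 fun he => huw ?_⟩
  · have : ⟪-z, w⟫ = 1 := by rw [inner_neg_left, ← he]; norm_num
    rw [inner_eq_one_iff_of_norm_eq_one (by simpa using hz) hw] at this
    rw [← this, inner_neg_right, huz, neg_zero]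
  · rw [inner_eq_one_iff_of_norm_eq_one hz hw] at he
    rw [← he, huz]

theorem exists_pt (n : ℕ) (hn : 2 ≤ n) (r : ℝ) (hr : r ∈ Set.Ioo 0 (π / 4))
    (p u : EuclideanSpace ℝ (Fin (n + 1))) (hp : ‖p‖ = 1) (hup : 0 < ⟪u, p⟫) :
    ∃ v, ‖v‖ = 1 ∧ Real.cos r < ⟪p, v⟫ ∧ ⟪p, v - (2 * ⟪u, v⟫) • u⟫ < Real.cos r := by
  have hp0 : p ≠ 0 := by rintro rfl; simp at hp
  haveI : Fact (Module.finrank ℝ (EuclideanSpace ℝ (Fin (n + 1))) = n + 1) := ⟨by simp⟩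
  have hfr : Module.finrank ℝ (ℝ ∙ p)ᗮ = n := Submodule.finrank_orthogonal_span_singleton hp0
  haveI : Nontrivial (ℝ ∙ p)ᗮ := Module.nontrivial_of_finrank_pos (R := ℝ) (by omega)
  obtain ⟨w0, hw0⟩ := exists_norm_eq (ℝ ∙ p)ᗮ (zero_le_one' ℝ)
  have hw0p : ⟪p, (w0 : EuclideanSpace ℝ (Fin (n + 1)))⟫ = 0 :=
    Submodule.mem_orthogonal_singleton_iff_inner_right.1 w0.2
  obtain ⟨w, hw, hpw, huw⟩ : ∃ w : EuclideanSpace ℝ (Fin (n + 1)), ‖w‖ = 1 ∧ ⟪p, w⟫ = 0 ∧ 0 ≤ ⟪u, w⟫ := by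
    rcases le_total 0 ⟪u, (w0 : EuclideanSpace ℝ (Fin (n + 1)))⟫ with h | h
    · exact ⟨w0, hw0, hw0p, h⟩
    · exact ⟨-w0, by rw [norm_neg]; exact hw0, by rw [inner_neg_right, hw0p, neg_zero],
        by rw [inner_neg_right]; linarith⟩
  have hpi := Real.pi_pos
  have hcr : 0 < Real.cos r := Real.cos_pos_of_mem_Ioo ⟨by linarith [hr.1], by linarith [hr.2]⟩
  -- choose the angle
  have hcont : Filter.Tendsto (fun δ => Real.cos δ - 2 * Real.cos δ * ⟪u, p⟫ ^ 2) (nhdsWithin r (Set.Iio r))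
      (nhds (Real.cos r - 2 * Real.cos r * ⟪u, p⟫ ^ 2)) := by
    apply Filter.Tendsto.mono_left _ nhdsWithin_le_nhds
    apply Continuous.tendsto
    fun_prop
  have hlt : Real.cos r - 2 * Real.cos r * ⟪u, p⟫ ^ 2 < Real.cos r := by
    have : 0 < 2 * Real.cos r * ⟪u, p⟫ ^ 2 := by positivity
    linarith
  have hev := hcont.eventually_lt_const hlt
  have hev2 : ∀ᶠ δ in nhdsWithin r (Set.Iio r), δ ∈ Set.Ioo 0 r := Ioo_mem_nhdsLT hr.1
  obtain ⟨δ, h1, h2⟩ := (hev.and hev2).exists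
  have hs : 0 ≤ Real.sin δ := Real.sin_nonneg_of_nonneg_of_le_pi h2.1.le (by linarith [h2.2, hr.2])
  have hcd : Real.cos r < Real.cos δ :=
    Real.cos_lt_cos_of_nonneg_of_le_pi h2.1.le (by linarith [hr.2]) h2.2
  have hpv : ⟪p, Real.cos δ • p + Real.sin δ • w⟫ = Real.cos δ := by
    rw [inner_add_right, real_inner_smul_right, real_inner_smul_right, hpw, real_inner_self_eq_norm_sq, hp]
    ring
  refine ⟨Real.cos δ • p + Real.sin δ • w, ?_, ?_, ?_⟩
  · have : ‖Real.cos δ • p + Real.sin δ • w‖ ^ 2 = 1 := by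
      rw [norm_add_sq_real, norm_smul, norm_smul, real_inner_smul_left, real_inner_smul_right, hpw, hp, hw,
        Real.norm_eq_abs, Real.norm_eq_abs, mul_one, mul_one, sq_abs, sq_abs]
      linarith [Real.cos_sq_add_sin_sq δ]
    exact (sq_eq_sq₀ (norm_nonneg _) zero_le_one).1 (by rw [this]; norm_num)
  · rw [hpv]; exact hcd
  · rw [inner_sub_right, hpv, real_inner_smul_right, real_inner_comm u p, inner_add_right,
      real_inner_smul_right, real_inner_smul_right]
    have : 0 ≤ Real.sin δ * ⟪u, w⟫ * ⟪u, p⟫ := by positivity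
    nlinarith

theorem integrable_crit (n : ℕ)
    (g : ℝ → ℝ) (hg_cont : ContinuousOn g (Set.Icc (-1) 1))
    (a z : EuclideanSpace ℝ (Fin (n + 1))) (ha : ‖a‖ = 1) (hz : ‖z‖ = 1) :
    IntegrableOn (fun v => g ⟪z, fold n a v⟫ • proj n z (fold n a v)) (sph n) μH[(n:ℝ)] := by
  have hms : MeasurableSet (sph n) := Metric.isClosed_sphere.measurableSet
  have hmem : ∀ v ∈ sph n, ⟪z, fold n a v⟫ ∈ Set.Icc (-1:ℝ) 1 := by
    intro v hv
    have hvn : ‖v‖ = 1 := by simpa [sph] using hv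
    have h := abs_real_inner_le_norm z (fold n a v)
    rwa [hz, norm_fold n a v ha, hvn, mul_one, abs_le] at h
  obtain ⟨M, hM⟩ := isCompact_Icc.exists_bound_of_continuousOn hg_cont
  have hle : (-1:ℝ) ≤ 1 := by norm_num
  have hg' : Continuous (Set.IccExtend hle (Set.restrict (Set.Icc (-1:ℝ) 1) g)) :=
    (continuousOn_iff_continuous_restrict.1 hg_cont).Icc_extend'
  have hmf := measurable_fold n a
  have hmeas : Measurable (fun v => (Set.IccExtend hle (Set.restrict (Set.Icc (-1:ℝ) 1) g)) ⟪z, fold n a v⟫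
      • proj n z (fold n a v)) := by
    refine Measurable.fun_smul ?_ ?_
    · exact hg'.measurable.comp ((by fun_prop : Continuous fun w => ⟪z, w⟫).measurable.comp hmf)
    · have : Continuous (proj n z) := by unfold proj; fun_prop
      exact this.measurable.comp hmf
  have hcongr : ∀ v ∈ sph n, (Set.IccExtend hle (Set.restrict (Set.Icc (-1:ℝ) 1) g)) ⟪z, fold n a v⟫
      • proj n z (fold n a v) = g ⟪z, fold n a v⟫ • proj n z (fold n a v) := by
    intro v hv
    rw [Set.IccExtend_of_mem _ _ (hmem v hv)]
    rfl
  refine IntegrableOn.congr_fun ?_ hcongr hms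
  refine Measure.integrableOn_of_bounded (M := M * 2) (sph_fin n).ne hmeas.aestronglyMeasurable ?_
  refine (ae_restrict_iff' hms).2 (Filter.Eventually.of_forall fun v hv => ?_)
  rw [hcongr v hv, norm_smul]
  have hvn : ‖v‖ = 1 := by simpa [sph] using hv
  have h1 := hM _ (hmem v hv)
  have h2 : ‖proj n z (fold n a v)‖ ≤ 2 := by
    unfold proj
    refine (norm_sub_le _ _).trans ?_
    have h3 := abs_real_inner_le_norm (fold n a v) z
    rw [norm_smul, Real.norm_eq_abs]
    rw [hz, norm_fold n a v ha, hvn] at *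
    linarith
  exact mul_le_mul h1 h2 (norm_nonneg _) ((norm_nonneg _).trans h1)

/-- For `r ∈ (0, π/4)` and `a, z, p ∈ Sⁿ`, if
`∫_{B_{p,r}} g(z·F_a v) π_z(F_a v) dv = 0` then `p` lies in the linear span of `a` and `z`. -/
theorem statement7 (n : ℕ) (hn : 2 ≤ n)
    (g : ℝ → ℝ) (hg_cont : ContinuousOn g (Set.Icc (-1) 1))
    (hg_even : ∀ t, g (-t) = g t)
    (hg_nonneg : ∀ t ∈ Set.Icc (-1:ℝ) 1, 0 ≤ g t)
    (hg_pos : ∀ t ∈ Set.Ioo (-1:ℝ) 1, 0 < g t)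
    (r : ℝ) (hr : r ∈ Set.Ioo 0 (π / 4))
    (a z p : EuclideanSpace ℝ (Fin (n + 1)))
    (ha : a ∈ sph n) (hz : z ∈ sph n) (hp : p ∈ sph n)
    (hcrit : (∫ v in gball n p r, g ⟪z, fold n a v⟫ • proj n z (fold n a v) ∂μH[(n:ℝ)]) = 0) :
    p ∈ Submodule.span ℝ ({a, z} : Set (EuclideanSpace ℝ (Fin (n + 1)))) := by
  by_contra hpK
  set K := Submodule.span ℝ ({a, z} : Set (EuclideanSpace ℝ (Fin (n + 1)))) with hK
  have han : ‖a‖ = 1 := by simpa [sph] using ha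
  have hzn : ‖z‖ = 1 := by simpa [sph] using hz
  have hpn : ‖p‖ = 1 := by simpa [sph] using hp
  -- the unit normal
  obtain ⟨u, hu, hua, huz, hup⟩ : ∃ u : EuclideanSpace ℝ (Fin (n + 1)),
      ‖u‖ = 1 ∧ ⟪u, a⟫ = 0 ∧ ⟪u, z⟫ = 0 ∧ 0 < ⟪u, p⟫ := by
    set u0 := p - K.starProjection p with hu0
    have hmem : u0 ∈ Kᗮ := Submodule.sub_starProjection_mem_orthogonal p
    have hne : u0 ≠ 0 := by
      intro h
      rw [hu0, sub_eq_zero] at h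
      exact hpK (h ▸ K.starProjection_apply_mem p)
    have hnp : 0 < ‖u0‖ := norm_pos_iff.2 hne
    have h1 : ∀ k ∈ K, ⟪u0, k⟫ = 0 := fun k hk => K.inner_left_of_mem_orthogonal hk hmem
    have h2 : ⟪u0, p⟫ = ‖u0‖ ^ 2 := by
      have : p = u0 + K.starProjection p := by rw [hu0]; abel
      rw [congrArg (fun x => ⟪u0, x⟫) this, inner_add_right, h1 _ (K.starProjection_apply_mem p), real_inner_self_eq_norm_sq, add_zero]
    refine ⟨‖u0‖⁻¹ • u0, ?_, ?_, ?_, ?_⟩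
    · rw [norm_smul, norm_inv, norm_norm, inv_mul_cancel₀ hnp.ne']
    · rw [real_inner_smul_left, h1 _ (Submodule.subset_span (by simp)), mul_zero]
    · rw [real_inner_smul_left, h1 _ (Submodule.subset_span (by simp)), mul_zero]
    · rw [real_inner_smul_left, h2]; positivity
  obtain ⟨ρ, hρ⟩ := exists_refl n u hu
  have hms : MeasurableSet (sph n) := Metric.isClosed_sphere.measurableSet
  set B := gball n p r with hB
  have hBiff := gball_iff n p hp r hr
  have hBs : B ⊆ sph n := fun v hv => hv.1
  have hBeq : B = sph n ∩ {v | Real.cos r < ⟪p, v⟫} := by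
    ext v; exact hBiff v
  have hBm : MeasurableSet B := by
    rw [hBeq]
    exact hms.inter (isOpen_lt continuous_const (by fun_prop)).measurableSet
  have hρm : Measurable ρ := ρ.continuous.measurable
  have hρB : MeasurableSet (ρ ⁻¹' B) := hρm hBm
  have hρs : ∀ v, ρ v ∈ sph n ↔ v ∈ sph n := by
    intro v; simp [sph]
  have huρ : ∀ v, ⟪u, ρ v⟫ = - ⟪u, v⟫ := by
    intro v
    rw [hρ, inner_sub_right, real_inner_smul_right, real_inner_self_eq_norm_sq, hu]; ring
  have hρρ : ∀ v, ρ (ρ v) = v := by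
    intro v
    rw [hρ (ρ v), huρ, hρ v]
    module
  set f : EuclideanSpace ℝ (Fin (n + 1)) → ℝ := fun v => g ⟪z, fold n a v⟫ * ⟪u, v⟫ with hf
  have hfeq : ∀ v, ⟪u, g ⟪z, fold n a v⟫ • proj n z (fold n a v)⟫ = f v := by
    intro v
    rw [real_inner_smul_right, hf]
    unfold proj
    rw [inner_sub_right, real_inner_smul_right, huz, inner_u_fold n a u v hua]
    ring
  have hintV := integrable_crit n g hg_cont a z han hzn
  have hintf : IntegrableOn f (sph n) μH[(n:ℝ)] := by
    have := hintV.const_inner (𝕜 := ℝ) u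
    simp only [hfeq] at this
    exact this
  have hB0 : ∫ v in B, f v ∂μH[(n:ℝ)] = 0 := by
    have := integral_inner (𝕜 := ℝ) (hintV.mono_set hBs) u
    rw [hcrit, inner_zero_right] at this
    simpa only [hfeq] using this
  have hfρ : ∀ v, f (ρ v) = - f v := by
    intro v
    simp only [hf]
    rw [huρ, hρ, inner_fold_refl n a z u v hua huz]
    ring
  -- the symmetric part
  have hsym : ∫ v in B ∩ ρ ⁻¹' B, f v ∂μH[(n:ℝ)] = 0 := by
    have hmp : MeasurePreserving ρ (μH[(n:ℝ)] : Measure (EuclideanSpace ℝ (Fin (n + 1)))) μH[(n:ℝ)] :=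
      ρ.toIsometryEquiv.measurePreserving_hausdorffMeasure _
    have hpre : ρ ⁻¹' (B ∩ ρ ⁻¹' B) = B ∩ ρ ⁻¹' B := by
      ext v
      simp only [Set.mem_preimage, Set.mem_inter_iff, hρρ]
      exact and_comm
    have h := hmp.setIntegral_preimage_emb ρ.toHomeomorph.measurableEmbedding f (B ∩ ρ ⁻¹' B)
    rw [hpre] at h
    simp only [hfρ, integral_neg] at h
    linarith
  have hsplit := integral_inter_add_sdiff hρB (hintf.mono_set hBs)
  rw [hsym, hB0, zero_add] at hsplit
  have hpos : ∀ v ∈ B \ ρ ⁻¹' B, 0 < f v := by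
    rintro v ⟨hv, hv'⟩
    have hvs := hBs hv
    have hvn : ‖v‖ = 1 := by simpa [sph] using hvs
    have h1 := ((hBiff v).1 hv).2
    have h2 : ⟪p, ρ v⟫ ≤ Real.cos r := by
      by_contra hcon
      exact hv' ((hBiff _).2 ⟨(hρs v).2 hvs, not_le.1 hcon⟩)
    rw [hρ, inner_sub_right, real_inner_smul_right, real_inner_comm u p] at h2
    have h3 : 0 < ⟪u, v⟫ := by
      by_contra hcon
      nlinarith
    have h4 := inner_lt n z u (fold n a v) hzn (by rw [norm_fold n a v han, hvn]) huz
      (by rw [inner_u_fold n a u v hua]; exact h3.ne')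
    exact mul_pos (hg_pos _ h4) h3
  have hDm : MeasurableSet (B \ ρ ⁻¹' B) := hBm.diff hρB
  have hkey := (setIntegral_pos_iff_support_of_nonneg_ae (μ := μH[(n:ℝ)]) (s := B \ ρ ⁻¹' B) (f := f)
    ((ae_restrict_iff' hDm).2 (Filter.Eventually.of_forall fun v hv => (hpos v hv).le))
    (hintf.mono_set (Set.diff_subset.trans hBs))).2 ?_
  · linarith
  · obtain ⟨v, hv1, hv2, hv3⟩ := exists_pt n hn r hr p u hpn hup
    have hO : IsOpen {v | Real.cos r < ⟪p, v⟫ ∧ ⟪p, v - (2 * ⟪u, v⟫) • u⟫ < Real.cos r} :=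
      IsOpen.and (isOpen_lt continuous_const (by fun_prop)) (isOpen_lt (by fun_prop) continuous_const)
    refine lt_of_lt_of_le (sph_open_pos n _ hO v ⟨hv2, hv3⟩ (by simpa [sph] using hv1)) (measure_mono ?_)
    rintro x ⟨⟨hx1, hx2⟩, hxs⟩
    have hxD : x ∈ B \ ρ ⁻¹' B := by
      refine ⟨(hBiff x).2 ⟨hxs, hx1⟩, fun hx => ?_⟩
      have := ((hBiff _).1 hx).2
      rw [hρ] at this
      linarith
    exact ⟨(hpos x hxD).ne', hxD⟩
end
end

section
/- Let n ≥ 2, r ∈ (0, π/4), and let a, z, p ∈ Sⁿ with z·a < 0. Suppose ∫_{B_{p,r}} g(z·F_a(v)) π_z(F_a(v)) dv = 0 and p ∉ {z, R_a(z)}. Then R_a(z) ≠ −z, and the point c := (z + R_a(z))/|z + R_a(z)| belongs to the closure of B_{p,r}. -/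
open MeasureTheory Real
open scoped RealInnerProductSpace

noncomputable section

abbrev EE (n : ℕ) := EuclideanSpace ℝ (Fin (n + 1))

lemma sph_inner {n : ℕ} {v : EE n} (hv : v ∈ sph n) : ⟪v, v⟫ = 1 := by
  have : ‖v‖ = 1 := by simpa [sph] using hv
  rw [real_inner_self_eq_norm_sq, this]; norm_num

lemma sph_of_inner {n : ℕ} {v : EE n} (hv : ⟪v, v⟫ = 1) : v ∈ sph n := by
  rw [real_inner_self_eq_norm_sq] at hv
  have : ‖v‖ = 1 := by nlinarith [norm_nonneg v]
  simpa [sph] using this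

lemma sph_abs {n : ℕ} {v w : EE n} (hv : v ∈ sph n) (hw : w ∈ sph n) : |⟪v, w⟫| ≤ 1 := by
  have h1 : ‖v‖ = 1 := by simpa [sph] using hv
  have h2 : ‖w‖ = 1 := by simpa [sph] using hw
  simpa [h1, h2] using abs_real_inner_le_norm v w

lemma mem_gball {n : ℕ} {p v : EE n} {r : ℝ} (hr : r ∈ Set.Ioo 0 (π / 4)) (hp : p ∈ sph n) :
    v ∈ gball n p r ↔ v ∈ sph n ∧ Real.cos r < ⟪p, v⟫ := by
  unfold gball
  simp only [Set.mem_ofPred_eq]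
  refine and_congr_right fun hv => ?_
  have h := abs_le.1 (sph_abs hp hv)
  have hpi := Real.pi_pos
  have hr' : r ∈ Set.Icc 0 π := ⟨hr.1.le, by linarith [hr.2]⟩
  have h3 := Real.strictAntiOn_cos.lt_iff_gt hr'
    (show Real.arccos ⟪p, v⟫ ∈ Set.Icc 0 π from ⟨Real.arccos_nonneg _, Real.arccos_le_pi _⟩)
  rw [Real.cos_arccos h.1 h.2] at h3
  exact h3.symm

lemma sph_meas (n : ℕ) : MeasurableSet (sph n) := Metric.isClosed_sphere.measurableSet

lemma gball_meas (n : ℕ) (p : EE n) (r : ℝ) : MeasurableSet (gball n p r) := by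
  have : gball n p r = sph n ∩ {v | Real.arccos ⟪p, v⟫ < r} := rfl
  rw [this]
  refine (sph_meas n).inter (IsOpen.measurableSet ?_)
  exact isOpen_lt (Real.continuous_arccos.comp (by fun_prop)) continuous_const

/-- sphRefl lemmas -/
lemma inner_sphRefl {n : ℕ} (w u v : EE n) :
    ⟪u, sphRefl n w v⟫ = ⟪u, v⟫ - 2 * ⟪v, w⟫ * ⟪u, w⟫ := by
  simp [sphRefl, inner_sub_right, inner_smul_right]

lemma sphRefl_inner {n : ℕ} (w u v : EE n) :
    ⟪sphRefl n w v, u⟫ = ⟪v, u⟫ - 2 * ⟪v, w⟫ * ⟪w, u⟫ := by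
  simp [sphRefl, inner_sub_left, inner_smul_left]

lemma sphRefl_invol {n : ℕ} {w : EE n} (hw : w ∈ sph n) (v : EE n) :
    sphRefl n w (sphRefl n w v) = v := by
  have h : ⟪sphRefl n w v, w⟫ = - ⟪v, w⟫ := by
    rw [sphRefl_inner, sph_inner hw]; ring
  rw [sphRefl, h, sphRefl]; module

lemma sphRefl_inner_inner {n : ℕ} {w : EE n} (hw : w ∈ sph n) (u v : EE n) :
    ⟪sphRefl n w u, sphRefl n w v⟫ = ⟪u, v⟫ := by
  rw [sphRefl_inner, inner_sphRefl, inner_sphRefl, sph_inner hw, real_inner_comm v w]; ring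

lemma sphRefl_sub {n : ℕ} (w u v : EE n) :
    sphRefl n w u - sphRefl n w v = sphRefl n w (u - v) := by
  simp only [sphRefl, inner_sub_left]; module

def reflIso {n : ℕ} {w : EE n} (hw : w ∈ sph n) : EE n ≃ᵢ EE n where
  toFun := sphRefl n w
  invFun := sphRefl n w
  left_inv := sphRefl_invol hw
  right_inv := sphRefl_invol hw
  isometry_toFun := by
    refine Isometry.of_dist_eq fun u v => ?_
    rw [dist_eq_norm, dist_eq_norm, sphRefl_sub, norm_eq_sqrt_real_inner, sphRefl_inner_inner hw,
      ← norm_eq_sqrt_real_inner]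

lemma refl_setIntegral {n : ℕ} {w : EE n} (hw : w ∈ sph n) {F : Type*} [NormedAddCommGroup F]
    [NormedSpace ℝ F] (f : EE n → F) (s : Set (EE n)) :
    ∫ v in sphRefl n w ⁻¹' s, f (sphRefl n w v) ∂μH[(n:ℝ)] = ∫ v in s, f v ∂μH[(n:ℝ)] :=
  ((reflIso hw).measurePreserving_hausdorffMeasure (n:ℝ)).setIntegral_preimage_emb
    (reflIso hw).toHomeomorph.measurableEmbedding f s

lemma sphRefl_mem {n : ℕ} {w v : EE n} (hw : w ∈ sph n) : sphRefl n w v ∈ sph n ↔ v ∈ sph n := by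
  constructor
  · intro h; have := sph_inner h; rw [sphRefl_inner_inner hw] at this; exact sph_of_inner this
  · intro h; apply sph_of_inner; rw [sphRefl_inner_inner hw]; exact sph_inner h

lemma sphRefl_cont {n : ℕ} (w : EE n) : Continuous (sphRefl n w) := by
  unfold sphRefl; fun_prop

lemma finrank_orth {n : ℕ} {v : EE n} (hv : v ∈ sph n) :
    Module.finrank ℝ (ℝ ∙ v)ᗮ = n := by
  have : Fact (Module.finrank ℝ (EE n) = n + 1) := ⟨by simp⟩
  apply Submodule.finrank_orthogonal_span_singleton
  rintro rfl
  simpa using sph_inner hv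

lemma haar_orth {n : ℕ} {v : EE n} (hv : v ∈ sph n) :
    (μH[(n:ℝ)] : Measure (ℝ ∙ v)ᗮ).IsAddHaarMeasure := by
  have := isAddHaarMeasure_hausdorffMeasure (E := (ℝ ∙ v)ᗮ)
  rwa [finrank_orth hv] at this

lemma open_pos {n : ℕ} {U : Set (EE n)} (hU : IsOpen U) {v : EE n} (hv : v ∈ sph n) (hvU : v ∈ U) :
    0 < μH[(n:ℝ)] (U ∩ sph n) := by
  have := haar_orth hv
  let V : Set (ℝ ∙ v)ᗮ := {y | ‖y‖ < 1 ∧ (y : EE n) + √(1 - ‖y‖ ^ 2) • v ∈ U}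
  have hV : IsOpen V := by
    refine (isOpen_lt continuous_norm continuous_const).inter ?_
    exact hU.preimage (f := fun y : (ℝ ∙ v)ᗮ => (y : EE n) + √(1 - ‖y‖ ^ 2) • v) (by fun_prop)
  have hV0 : V.Nonempty := ⟨0, by simpa [V] using hvU⟩
  have hpos := hV.measure_pos (μ := (μH[(n:ℝ)] : Measure (ℝ ∙ v)ᗮ)) hV0
  have hle := hausdorffMeasure_orthogonalProjectionOnto_le (𝕜 := ℝ) (ℝ ∙ v)ᗮ (U ∩ sph n) (d := (n:ℝ)) (by positivity)
  refine lt_of_lt_of_le hpos (le_trans (measure_mono ?_) hle)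
  rintro y ⟨hy1, hy2⟩
  have hyv : ⟪(y : EE n), v⟫ = 0 := by
    have := y.2
    rw [Submodule.mem_orthogonal_singleton_iff_inner_left] at this
    exact this
  refine ⟨_, ⟨hy2, ?_⟩, ?_⟩
  · apply sph_of_inner
    have h0 : 0 ≤ 1 - ‖y‖ ^ 2 := by nlinarith [norm_nonneg y]
    have h1 : ⟪(y : EE n), (y : EE n)⟫ = ‖y‖ ^ 2 := by rw [real_inner_self_eq_norm_sq]; rfl
    have h2 := Real.mul_self_sqrt h0
    simp only [inner_add_left, inner_add_right, inner_smul_left, inner_smul_right, sph_inner hv, hyv,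
      real_inner_comm (y : EE n) v, h1]
    simp only [conj_trivial, mul_zero, mul_one, add_zero, zero_add]
    linarith
  · rw [map_add, Submodule.orthogonalProjectionOnto_mem_subspace_eq_self,
      Submodule.orthogonalProjectionOnto_eq_zero_iff.2, add_zero]
    apply Submodule.le_orthogonal_orthogonal
    exact Submodule.smul_mem _ _ (Submodule.mem_span_singleton_self v)

lemma normalize_lip {n : ℕ} {x y : EE n} (hx : 1 ≤ ‖x‖) (hy : 1 ≤ ‖y‖) :
    ‖‖x‖⁻¹ • x - ‖y‖⁻¹ • y‖ ≤ ‖x - y‖ := by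
  apply le_of_sq_le_sq _ (norm_nonneg _)
  have hx0 : ‖x‖ ≠ 0 := by positivity
  have hy0 : ‖y‖ ≠ 0 := by positivity
  rw [norm_sub_sq_real, norm_sub_sq_real, norm_smul, norm_smul, norm_inv, norm_inv, norm_norm,
    norm_norm, inv_mul_cancel₀ hx0, inv_mul_cancel₀ hy0, inner_smul_left, inner_smul_right]
  have h := real_inner_le_norm x y
  simp only [conj_trivial]
  set m := ‖x‖ * ‖y‖ with hm
  have hm1 : 1 ≤ m := by nlinarith
  have : ‖x‖⁻¹ * (‖y‖⁻¹ * ⟪x, y⟫) = ⟪x, y⟫ / m := by rw [hm]; field_simp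
  rw [this]
  have h2 : ⟪x, y⟫ / m * m = ⟪x, y⟫ := by field_simp
  have h3 : ⟪x, y⟫ / m ≤ 1 := by rw [div_le_one (by positivity)]; exact h
  nlinarith [sq_nonneg (‖x‖ - ‖y‖), mul_nonneg (sub_nonneg.2 hm1) (sub_nonneg.2 h3)]

lemma gball_fin {n : ℕ} {p : EE n} {r : ℝ} (hr : r ∈ Set.Ioo 0 (π / 4)) (hp : p ∈ sph n) :
    μH[(n:ℝ)] (gball n p r) < ⊤ := by
  have := haar_orth hp
  have hcos : 0 < Real.cos r := Real.cos_pos_of_mem_Ioo ⟨by linarith [hr.1, Real.pi_pos], by linarith [hr.2, Real.pi_pos]⟩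
  have hp1 : ‖p‖ = 1 := by simpa [sph] using hp
  have horth : ∀ y : (ℝ ∙ p)ᗮ, ⟪p, (y : EE n)⟫ = 0 := fun y => by
    have := y.2
    rw [Submodule.mem_orthogonal_singleton_iff_inner_right] at this
    exact this
  have hge : ∀ y : (ℝ ∙ p)ᗮ, 1 ≤ ‖p + (y : EE n)‖ := fun y => by
    have h := norm_add_sq_real p (y : EE n)
    rw [horth, hp1] at h
    nlinarith [norm_nonneg (p + (y : EE n)), sq_nonneg ‖(y : EE n)‖]
  let f : (ℝ ∙ p)ᗮ → EE n := fun y => ‖p + (y : EE n)‖⁻¹ • (p + (y : EE n))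
  have hf : LipschitzWith 1 f := by
    refine LipschitzWith.of_dist_le_mul fun x y => ?_
    rw [dist_eq_norm, dist_eq_norm]
    refine (normalize_lip (hge x) (hge y)).trans ?_
    simp
  have hle := hf.hausdorffMeasure_image_le (d := (n:ℝ)) (by positivity) (Metric.closedBall 0 ((Real.cos r)⁻¹ + 1))
  have hfin : μH[(n:ℝ)] (Metric.closedBall (0 : (ℝ ∙ p)ᗮ) ((Real.cos r)⁻¹ + 1)) < ⊤ :=
    (isCompact_closedBall _ _).measure_lt_top
  refine lt_of_le_of_lt (measure_mono ?_) (lt_of_le_of_lt hle (by simpa using hfin))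
  intro v hv
  rw [mem_gball hr hp] at hv
  obtain ⟨hv, hpv⟩ := hv
  have hv1 : ‖v‖ = 1 := by simpa [sph] using hv
  have hpos : 0 < ⟪p, v⟫ := hcos.trans hpv
  refine ⟨⟨(⟪p, v⟫)⁻¹ • v - p, ?_⟩, ?_, ?_⟩
  · rw [Submodule.mem_orthogonal_singleton_iff_inner_right, inner_sub_right, inner_smul_right, sph_inner hp]
    field_simp; ring
  · rw [mem_closedBall_zero_iff]
    change ‖(⟪p, v⟫)⁻¹ • v - p‖ ≤ _
    refine (norm_sub_le _ _).trans ?_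
    rw [norm_smul, hv1, hp1, norm_inv, Real.norm_of_nonneg hpos.le, mul_one]
    gcongr
  · simp only [f, add_sub_cancel, norm_smul, hv1, norm_inv, Real.norm_of_nonneg hpos.le, mul_one, inv_inv, smul_smul]
    rw [mul_inv_cancel₀ hpos.ne', one_smul]

lemma pos_int_ne {n : ℕ} {S : Set (EE n)} (hS : MeasurableSet S) {h : EE n → ℝ}
    (hi : IntegrableOn h S μH[(n:ℝ)]) (hpos : ∀ v ∈ S, 0 < h v) (hm : 0 < μH[(n:ℝ)] S) :
    0 < ∫ v in S, h v ∂μH[(n:ℝ)] := by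
  rw [setIntegral_pos_iff_support_of_nonneg_ae _ hi]
  · rwa [Set.inter_eq_right.2 (show S ⊆ Function.support h from fun v hv => (hpos v hv).ne')]
  · exact (ae_restrict_iff' hS).2 (Filter.Eventually.of_forall fun v hv => (hpos v hv).le)

lemma exists_perp {n : ℕ} (hn : 2 ≤ n) {p : EE n} (hp : p ∈ sph n) :
    ∃ e : EE n, e ∈ sph n ∧ ⟪p, e⟫ = 0 := by
  have h := finrank_orth hp
  have : Nontrivial (ℝ ∙ p)ᗮ := Module.nontrivial_of_finrank_pos (R := ℝ) (by omega)
  obtain ⟨y, hy⟩ := exists_norm_eq (ℝ ∙ p)ᗮ (zero_le_one (α := ℝ))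
  refine ⟨y, by simpa [sph] using hy, ?_⟩
  have := y.2
  rw [Submodule.mem_orthogonal_singleton_iff_inner_right] at this
  exact this

lemma diff_pos {n : ℕ} (hn : 2 ≤ n) {p w : EE n} {r : ℝ} (hr : r ∈ Set.Ioo 0 (π / 4))
    (hp : p ∈ sph n) (hw : w ∈ sph n) (hpw : 0 < ⟪p, w⟫) :
    0 < μH[(n:ℝ)] (gball n p r \ sphRefl n w ⁻¹' gball n p r) := by
  have hcos : 0 < Real.cos r := Real.cos_pos_of_mem_Ioo ⟨by linarith [hr.1, Real.pi_pos], by linarith [hr.2, Real.pi_pos]⟩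
  have hsin : 0 < Real.sin r := Real.sin_pos_of_pos_of_lt_pi hr.1 (by linarith [hr.2, Real.pi_pos])
  obtain ⟨e, he, hpe, hew⟩ : ∃ e : EE n, e ∈ sph n ∧ ⟪p, e⟫ = 0 ∧ 0 ≤ ⟪e, w⟫ := by
    obtain ⟨e, he, hpe⟩ := exists_perp hn hp
    rcases le_total 0 ⟪e, w⟫ with h | h
    · exact ⟨e, he, hpe, h⟩
    · refine ⟨-e, by simpa [sph] using he, by simp [hpe], by simpa using h⟩
  let v : ℝ → EE n := fun s => Real.cos s • p + Real.sin s • e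
  have hvc : Continuous v := by fun_prop
  have hvp : ∀ s, ⟪p, v s⟫ = Real.cos s := fun s => by
    simp only [v, inner_add_right, inner_smul_right, hpe, sph_inner hp]; ring
  have hvs : ∀ s, v s ∈ sph n := fun s => by
    apply sph_of_inner
    have hep : ⟪e, p⟫ = 0 := by rw [real_inner_comm]; exact hpe
    simp only [v, inner_add_right, inner_add_left, inner_smul_right, inner_smul_left, hpe, hep,
      sph_inner hp, sph_inner he, conj_trivial]
    nlinarith [Real.sin_sq_add_cos_sq s]
  have hvw : 0 < ⟪v r, w⟫ := by
    simp only [v, inner_add_left, inner_smul_left, conj_trivial]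
    have := mul_pos hcos hpw
    have := mul_nonneg hsin.le hew
    linarith
  have hlt : ⟪p, sphRefl n w (v r)⟫ < Real.cos r := by
    rw [inner_sphRefl, hvp]
    have := mul_pos hvw hpw
    linarith
  have hc : Continuous fun s => ⟪p, sphRefl n w (v s)⟫ :=
    continuous_const.inner ((sphRefl_cont w).comp hvc)
  have hev : ∀ᶠ s in nhdsWithin r (Set.Iio r), ⟪p, sphRefl n w (v s)⟫ < Real.cos r :=
    (hc.continuousAt.eventually_lt continuousAt_const hlt).filter_mono nhdsWithin_le_nhds
  have hev2 : ∀ᶠ s in nhdsWithin r (Set.Iio r), s ∈ Set.Ioo 0 r := Ioo_mem_nhdsLT hr.1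
  obtain ⟨s, hs1, hs2⟩ := (hev.and hev2).exists
  have hsr : Real.cos r < Real.cos s :=
    Real.cos_lt_cos_of_nonneg_of_le_pi hs2.1.le (by linarith [hr.2, Real.pi_pos]) hs2.2
  have hO : IsOpen ({x : EE n | Real.cos r < ⟪p, x⟫} ∩ {x | ⟪p, sphRefl n w x⟫ < Real.cos r}) :=
    (isOpen_lt continuous_const (by fun_prop)).inter
      (isOpen_lt (continuous_const.inner (sphRefl_cont w)) continuous_const)
  refine lt_of_lt_of_le (open_pos hO (hvs s) ⟨by simpa [hvp] using hsr, hs1⟩) (measure_mono ?_)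
  rintro x ⟨⟨hx1, hx2⟩, hx3⟩
  refine ⟨(mem_gball hr hp).2 ⟨hx3, hx1⟩, fun hx => ?_⟩
  have := ((mem_gball hr hp).1 hx).2
  exact lt_asymm this hx2

lemma keyA {n : ℕ} (hn : 2 ≤ n) {p w : EE n} {r : ℝ} (hr : r ∈ Set.Ioo 0 (π / 4))
    (hp : p ∈ sph n) (hw : w ∈ sph n) (hpw : 0 < ⟪p, w⟫) {h : EE n → ℝ}
    (hi : IntegrableOn h (gball n p r) μH[(n:ℝ)])
    (hodd : ∀ v ∈ gball n p r, sphRefl n w v ∈ gball n p r → h (sphRefl n w v) = - h v)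
    (hpos : ∀ v ∈ gball n p r, 0 < ⟪w, v⟫ → 0 < h v) :
    0 < ∫ v in gball n p r, h v ∂μH[(n:ℝ)] := by
  set B := gball n p r with hB
  have hBm : MeasurableSet B := gball_meas n p r
  have hRm : MeasurableSet (sphRefl n w ⁻¹' B) := (sphRefl_cont w).measurable hBm
  rw [← integral_inter_add_sdiff hRm hi]
  have h0 : ∫ v in B ∩ sphRefl n w ⁻¹' B, h v ∂μH[(n:ℝ)] = 0 := by
    have h1 := refl_setIntegral hw h (B ∩ sphRefl n w ⁻¹' B)
    have h2 : sphRefl n w ⁻¹' (B ∩ sphRefl n w ⁻¹' B) = B ∩ sphRefl n w ⁻¹' B := by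
      ext v
      simp only [Set.mem_preimage, Set.mem_inter_iff, sphRefl_invol hw]
      tauto
    rw [h2, setIntegral_congr_fun (g := fun v => - h v) (hBm.inter hRm)
      (fun v hv => hodd v hv.1 hv.2), integral_neg] at h1
    linarith
  rw [h0, zero_add]
  refine pos_int_ne (hBm.diff hRm) (hi.mono_set Set.sdiff_subset) ?_ (diff_pos hn hr hp hw hpw)
  rintro v ⟨hv1, hv2⟩
  refine hpos v hv1 ?_
  have hv := (mem_gball hr hp).1 hv1
  by_contra hcon
  apply hv2
  refine (mem_gball hr hp).2 ⟨(sphRefl_mem hw).2 hv.1, ?_⟩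
  rw [inner_sphRefl, real_inner_comm]
  have := mul_nonneg (neg_nonneg.2 (not_lt.1 hcon)) hpw.le
  rw [real_inner_comm] at hcon
  have e : ⟪v, w⟫ = ⟪w, v⟫ := real_inner_comm _ _
  rw [real_inner_comm p v, e]
  linarith [hv.2]

lemma fold_mem {n : ℕ} {a v : EE n} (ha : a ∈ sph n) (hv : v ∈ sph n) : fold n a v ∈ sph n := by
  unfold fold; split_ifs
  · exact (sphRefl_mem ha).2 hv
  · exact hv

lemma fold_meas {n : ℕ} (a : EE n) : Measurable (fold n a) := by
  unfold fold
  refine Measurable.ite ?_ (sphRefl_cont a).measurable measurable_id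
  exact (isOpen_lt continuous_const (by fun_prop)).measurableSet

lemma fold_refl {n : ℕ} {a : EE n} (ha : a ∈ sph n) (v : EE n) :
    fold n a (sphRefl n a v) = fold n a v := by
  have h : ⟪sphRefl n a v, a⟫ = - ⟪v, a⟫ := by rw [sphRefl_inner, sph_inner ha]; ring
  unfold fold
  rw [h, sphRefl_invol ha]
  rcases lt_trichotomy ⟪v, a⟫ 0 with h1 | h1 | h1
  · rw [if_pos (by linarith), if_neg (by linarith)]
  · rw [if_neg (by linarith), if_neg (by linarith)]; simp [sphRefl, h1]
  · rw [if_neg (by linarith), if_pos (by linarith)]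

lemma inner_fold {n : ℕ} {a w : EE n} (haw : ⟪w, a⟫ = 0) (v : EE n) :
    ⟪w, fold n a v⟫ = ⟪w, v⟫ := by
  unfold fold; split_ifs
  · rw [inner_sphRefl, haw]; ring
  · rfl

lemma fold_comm {n : ℕ} {a w : EE n} (haw : ⟪w, a⟫ = 0) (v : EE n) :
    fold n a (sphRefl n w v) = sphRefl n w (fold n a v) := by
  have h : ⟪sphRefl n w v, a⟫ = ⟪v, a⟫ := by rw [sphRefl_inner, haw]; ring
  have h' : ⟪a, w⟫ = 0 := by rw [real_inner_comm]; exact haw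
  unfold fold
  rw [h]
  split_ifs
  · simp only [sphRefl, inner_sub_left, inner_smul_left, haw, h']
    simp; module
  · rfl

lemma K_int {n : ℕ} {g : ℝ → ℝ} (hg : ContinuousOn g (Set.Icc (-1) 1)) {r : ℝ}
    (hr : r ∈ Set.Ioo 0 (π / 4)) {a z p : EE n} (ha : a ∈ sph n) (hz : z ∈ sph n) (hp : p ∈ sph n) :
    IntegrableOn (fun v => g ⟪z, fold n a v⟫ • proj n z (fold n a v)) (gball n p r) μH[(n:ℝ)] := by
  let g' : ℝ → ℝ := Set.IccExtend (by norm_num : (-1:ℝ) ≤ 1) ((Set.Icc (-1:ℝ) 1).domRestrict g)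
  have hg' : Continuous g' := (continuousOn_iff_continuous_domRestrict.1 hg).Icc_extend'
  have hin : ∀ v ∈ gball n p r, ⟪z, fold n a v⟫ ∈ Set.Icc (-1:ℝ) 1 := fun v hv =>
    abs_le.1 (sph_abs hz (fold_mem ha hv.1))
  have heq : ∀ t ∈ Set.Icc (-1:ℝ) 1, g' t = g t := fun t ht => Set.IccExtend_of_mem _ _ ht
  obtain ⟨C, hC⟩ := isCompact_Icc.exists_bound_of_continuousOn hg
  have hmeas : Measurable (fun v => g' ⟪z, fold n a v⟫ • proj n z (fold n a v)) := by
    have h1 := fold_meas a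
    have h2 : Continuous (fun u : EE n => g' ⟪z, u⟫ • proj n z u) := by
      unfold proj; fun_prop
    exact h2.measurable.comp h1
  have hi : IntegrableOn (fun v => g' ⟪z, fold n a v⟫ • proj n z (fold n a v)) (gball n p r) μH[(n:ℝ)] := by
    refine Measure.integrableOn_of_bounded (M := C * 2) (gball_fin hr hp).ne hmeas.aestronglyMeasurable ?_
    refine (ae_restrict_iff' (gball_meas n p r)).2 (Filter.Eventually.of_forall fun v hv => ?_)
    rw [heq _ (hin v hv), norm_smul]
    have h1 := hC _ (hin v hv)
    have hu : ‖fold n a v‖ = 1 := by simpa [sph] using fold_mem ha hv.1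
    have hz1 : ‖z‖ = 1 := by simpa [sph] using hz
    have h2 : ‖proj n z (fold n a v)‖ ≤ 2 := by
      unfold proj
      refine (norm_sub_le _ _).trans ?_
      rw [norm_smul, hu, hz1, Real.norm_eq_abs]
      linarith [sph_abs (fold_mem ha hv.1) hz]
    exact mul_le_mul h1 h2 (norm_nonneg _) ((norm_nonneg _).trans h1)
  exact hi.congr_fun (fun v hv => by simp only [heq _ (hin v hv)]) (gball_meas n p r)

lemma K_test {n : ℕ} {g : ℝ → ℝ} (hg : ContinuousOn g (Set.Icc (-1) 1)) {r : ℝ}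
    (hr : r ∈ Set.Ioo 0 (π / 4)) {a z p : EE n} (ha : a ∈ sph n) (hz : z ∈ sph n) (hp : p ∈ sph n)
    (hcrit : (∫ v in gball n p r, g ⟪z, fold n a v⟫ • proj n z (fold n a v) ∂μH[(n:ℝ)]) = 0)
    {w : EE n} (hw : ⟪w, z⟫ = 0) :
    IntegrableOn (fun v => g ⟪z, fold n a v⟫ * ⟪w, fold n a v⟫) (gball n p r) μH[(n:ℝ)] ∧
    ∫ v in gball n p r, g ⟪z, fold n a v⟫ * ⟪w, fold n a v⟫ ∂μH[(n:ℝ)] = 0 := by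
  have hi := K_int hg hr ha hz hp
  have he : (fun v => g ⟪z, fold n a v⟫ * ⟪w, fold n a v⟫) =
      fun v => ⟪w, g ⟪z, fold n a v⟫ • proj n z (fold n a v)⟫ := by
    ext v
    simp [proj, inner_smul_right, inner_sub_right, hw]
  rw [he]
  refine ⟨hi.const_inner w, ?_⟩
  rw [integral_inner hi, hcrit, inner_zero_right]

/-- positivity of `g` at points off the axis -/
lemma g_pos_of {n : ℕ} {g : ℝ → ℝ} (hg_pos : ∀ t ∈ Set.Ioo (-1:ℝ) 1, 0 < g t)
    {z w u : EE n} (hz : z ∈ sph n) (hu : u ∈ sph n) (hw : ⟪w, z⟫ = 0) (hwu : ⟪w, u⟫ ≠ 0) :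
    0 < g ⟪z, u⟫ := by
  apply hg_pos
  have hz1 : ‖z‖ = 1 := by simpa [sph] using hz
  have hu1 : ‖u‖ = 1 := by simpa [sph] using hu
  have h := abs_le.1 (sph_abs hz hu)
  refine ⟨lt_of_le_of_ne h.1 fun h1 => hwu ?_, lt_of_le_of_ne h.2 fun h1 => hwu ?_⟩
  · have : z = -u := by
      rw [← inner_eq_one_iff_of_norm_eq_one (𝕜 := ℝ) hz1 (by simpa using hu1)]
      rw [inner_neg_right, ← h1]; norm_num
    rw [this, inner_neg_right] at hw; linarith
  · have : z = u := (inner_eq_one_iff_of_norm_eq_one (𝕜 := ℝ) hz1 hu1).1 h1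
    rw [← this]; exact hw

lemma span_lem {n : ℕ} (hn : 2 ≤ n) {g : ℝ → ℝ} (hg : ContinuousOn g (Set.Icc (-1) 1))
    (hg_pos : ∀ t ∈ Set.Ioo (-1:ℝ) 1, 0 < g t) {r : ℝ}
    (hr : r ∈ Set.Ioo 0 (π / 4)) {a z p : EE n} (ha : a ∈ sph n) (hz : z ∈ sph n) (hp : p ∈ sph n)
    (hcrit : (∫ v in gball n p r, g ⟪z, fold n a v⟫ • proj n z (fold n a v) ∂μH[(n:ℝ)]) = 0)
    {w : EE n} (hwa : ⟪w, a⟫ = 0) (hwz : ⟪w, z⟫ = 0) : ⟪p, w⟫ = 0 := by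
  have key : ∀ w : EE n, w ∈ sph n → ⟪w, a⟫ = 0 → ⟪w, z⟫ = 0 → ¬ 0 < ⟪p, w⟫ := by
    intro w hw hwa hwz hpw
    obtain ⟨hi, h0⟩ := K_test hg hr ha hz hp hcrit hwz
    have := keyA hn hr hp hw hpw hi ?_ ?_
    · exact this.ne' h0
    · intro v _ _
      have hzw : ⟪z, w⟫ = 0 := by rw [real_inner_comm]; exact hwz
      simp only [fold_comm hwa, inner_sphRefl, hzw, sph_inner hw]
      rw [real_inner_comm w (fold n a v), mul_zero, sub_zero]; ring
    · intro v hv hwv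
      have h1 : 0 < ⟪w, fold n a v⟫ := by rwa [inner_fold hwa]
      exact mul_pos (g_pos_of hg_pos hz (fold_mem ha hv.1) hwz h1.ne') h1
  by_contra hne
  have hw0 : w ≠ 0 := by rintro rfl; simp at hne
  have hn0 : 0 < ‖w‖ := norm_pos_iff.2 hw0
  have hs : ‖w‖⁻¹ • w ∈ sph n := by
    simp [sph, norm_smul, hn0.ne']
  rcases lt_or_gt_of_ne hne with h | h
  · refine key (-(‖w‖⁻¹ • w)) (by simpa [sph] using hs) ?_ ?_ ?_
    · rw [inner_neg_left, inner_smul_left, hwa]; simp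
    · rw [inner_neg_left, inner_smul_left, hwz]; simp
    · rw [inner_neg_right, inner_smul_right]
      have := mul_pos (inv_pos.2 hn0) (neg_pos.2 h)
      linarith
  · refine key (‖w‖⁻¹ • w) hs ?_ ?_ ?_
    · rw [inner_smul_left, hwa]; simp
    · rw [inner_smul_left, hwz]; simp
    · rw [inner_smul_right]; exact mul_pos (inv_pos.2 hn0) h

set_option maxHeartbeats 800000 in
lemma core {n : ℕ} (hn : 2 ≤ n) {g : ℝ → ℝ} (hg : ContinuousOn g (Set.Icc (-1) 1))
    (hg_pos : ∀ t ∈ Set.Ioo (-1:ℝ) 1, 0 < g t) {r : ℝ}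
    (hr : r ∈ Set.Ioo 0 (π / 4)) {a z p : EE n} (ha : a ∈ sph n) (hz : z ∈ sph n) (hp : p ∈ sph n)
    (hcrit : (∫ v in gball n p r, g ⟪z, fold n a v⟫ • proj n z (fold n a v) ∂μH[(n:ℝ)]) = 0)
    (hpz : p ≠ z) (hpa : ⟪p, a⟫ ≤ 0) {c : EE n} {C S : ℝ} (hc : c ∈ sph n) (hca : ⟪c, a⟫ = 0)
    (hC : 0 < C) (hS : 0 < S) (hzc : z = C • c - S • a) : Real.cos r < ⟪p, c⟫ := by
  have hcos : 0 < Real.cos r := Real.cos_pos_of_mem_Ioo ⟨by linarith [hr.1, Real.pi_pos], by linarith [hr.2, Real.pi_pos]⟩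
  have hsin : 0 < Real.sin r := Real.sin_pos_of_pos_of_lt_pi hr.1 (by linarith [hr.2, Real.pi_pos])
  have hsc : Real.sin r < Real.cos r := by
    rw [← Real.cos_pi_div_two_sub]
    exact Real.cos_lt_cos_of_nonneg_of_le_pi hr.1.le (by linarith [hr.1, Real.pi_pos]) (by linarith [hr.2])
  have hsq := Real.sin_sq_add_cos_sq r
  have hac : ⟪a, c⟫ = 0 := by rw [real_inner_comm]; exact hca
  have hcc := sph_inner hc
  have haa := sph_inner ha
  have hCS : C ^ 2 + S ^ 2 = 1 := by
    have h := sph_inner hz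
    rw [hzc] at h
    simp only [inner_sub_left, inner_sub_right, inner_smul_left, inner_smul_right, hca, hac, hcc, haa,
      conj_trivial] at h
    linarith
  obtain ⟨x, hx⟩ : ∃ x, x = ⟪p, c⟫ := ⟨_, rfl⟩
  obtain ⟨y, hy⟩ : ∃ y, y = -⟪p, a⟫ := ⟨_, rfl⟩
  have hy0 : 0 ≤ y := by linarith
  have hpxy : p = x • c - y • a := by
    have hqa : ⟪p - (x • c - y • a), a⟫ = 0 := by
      simp only [inner_sub_left, inner_smul_left, hca, haa, conj_trivial]; linarith
    have hqc : ⟪p - (x • c - y • a), c⟫ = 0 := by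
      simp only [inner_sub_left, inner_smul_left, hac, hcc, conj_trivial]; linarith
    have hqz : ⟪p - (x • c - y • a), z⟫ = 0 := by
      rw [hzc, inner_sub_right, inner_smul_right, inner_smul_right, hqa, hqc]; ring
    have hqp := span_lem hn hg hg_pos hr ha hz hp hcrit hqa hqz
    have : ⟪p - (x • c - y • a), p - (x • c - y • a)⟫ = 0 := by
      rw [inner_sub_right, inner_sub_right, inner_smul_right, inner_smul_right, hqa, hqc,
        real_inner_comm, hqp]; ring
    exact sub_eq_zero.1 (inner_self_eq_zero.1 this)
  have hxy : x ^ 2 + y ^ 2 = 1 := by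
    have h := sph_inner hp
    rw [hpxy] at h
    simp only [inner_sub_left, inner_sub_right, inner_smul_left, inner_smul_right, hca, hac, hcc, haa,
      conj_trivial] at h
    linarith
  have hpv : ∀ v, ⟪p, v⟫ = x * ⟪c, v⟫ - y * ⟪a, v⟫ := fun v => by
    rw [hpxy]; simp only [inner_sub_left, inner_smul_left, conj_trivial]
  rw [← hx]
  by_contra hcon
  push Not at hcon
  obtain ⟨w, hw⟩ : ∃ w : EE n, w = -(S • c) - C • a := ⟨_, rfl⟩
  have hwv : ∀ v, ⟪w, v⟫ = -S * ⟪c, v⟫ - C * ⟪a, v⟫ := fun v => by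
    rw [hw]; simp only [inner_sub_left, inner_smul_left, inner_neg_left, conj_trivial]; ring
  have hwc : ⟪w, c⟫ = -S := by rw [hwv, hcc, hac]; ring
  have hwa : ⟪w, a⟫ = -C := by rw [hwv, haa, hca]; ring
  have hwz : ⟪w, z⟫ = 0 := by
    rw [hzc, inner_sub_right, inner_smul_right, inner_smul_right, hwc, hwa]; ring
  have hws : w ∈ sph n := by
    apply sph_of_inner
    rw [hwv, real_inner_comm w c, real_inner_comm w a, hwc, hwa]; linarith
  have hwp : ⟪p, w⟫ = -S * x + C * y := by
    rw [hpv, real_inner_comm w c, real_inner_comm w a, hwc, hwa]; ring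
  obtain ⟨hi, h0⟩ := K_test hg hr ha hz hp hcrit hwz
  rcases le_or_gt (-Real.cos r) x with hx1 | hx1
  · -- ball does not cross the hyperplane
    have hfold : ∀ v ∈ gball n p r, fold n a v = v := by
      intro v hv
      have hv' := (mem_gball hr hp).1 hv
      unfold fold
      rw [if_neg]
      intro hva
      rw [real_inner_comm] at hva
      have h1 := hv'.2
      rw [hpv] at h1
      have h2 := sph_abs hc hv'.1
      have h3 : |x| ≤ Real.cos r := abs_le.2 ⟨hx1, hcon⟩
      have h4 : x * ⟪c, v⟫ ≤ Real.cos r := by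
        calc x * ⟪c, v⟫ ≤ |x * ⟪c, v⟫| := le_abs_self _
          _ = |x| * |⟪c, v⟫| := abs_mul _ _
          _ ≤ Real.cos r * 1 := mul_le_mul h3 h2 (abs_nonneg _) hcos.le
          _ = Real.cos r := mul_one _
      nlinarith [mul_nonneg hy0 hva.le]
    have hzw : ⟪z, w⟫ = 0 := by rw [real_inner_comm]; exact hwz
    have key : ∀ w : EE n, w ∈ sph n → ⟪w, z⟫ = 0 → ¬ 0 < ⟪p, w⟫ := by
      intro w hws hwz hpw
      obtain ⟨hi, h0⟩ := K_test hg hr ha hz hp hcrit hwz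
      refine (keyA hn hr hp hws hpw hi ?_ ?_).ne' h0
      · intro v hv hv2
        have hzw : ⟪z, w⟫ = 0 := by rw [real_inner_comm]; exact hwz
        simp only [hfold v hv, hfold _ hv2, inner_sphRefl, hzw, sph_inner hws]
        rw [real_inner_comm w v, mul_zero, sub_zero]; ring
      · intro v hv hwv
        have h1 : 0 < ⟪w, fold n a v⟫ := by rwa [hfold v hv]
        exact mul_pos (g_pos_of hg_pos hz (fold_mem ha hv.1) hwz h1.ne') h1
    have hk1 := key w hws hwz
    have hk2 := key (-w) (by simpa [sph] using hws) (by simp [hwz])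
    rw [inner_neg_right] at hk2
    have h3 : -S * x + C * y = 0 := by rw [← hwp]; linarith
    have hl1 : x = (x * C + y * S) * C := by
      linear_combination (-x) * hCS - S * h3
    have hl2 : y = (x * C + y * S) * S := by
      linear_combination (-y) * hCS + C * h3
    obtain ⟨l, hl⟩ : ∃ l, l = x * C + y * S := ⟨_, rfl⟩
    rw [← hl] at hl1 hl2
    have hl0 : 0 ≤ l := by
      by_contra hneg
      push Not at hneg
      nlinarith [mul_pos hS (neg_pos.2 hneg)]
    have hll : l ^ 2 = 1 := by
      rw [hl1, hl2] at hxy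
      linear_combination hxy - l ^ 2 * hCS
    have hl3 : l = 1 := (pow_eq_one_iff_of_nonneg hl0 two_ne_zero).1 hll
    apply hpz
    rw [hpxy, hzc, hl1, hl2, hl3, one_mul, one_mul]
  · have hpos : ∀ v ∈ gball n p r, 0 < ⟪w, fold n a v⟫ := by
      intro v hv
      have hv' := (mem_gball hr hp).1 hv
      have h1 := hv'.2
      rw [hpv] at h1
      have h2 := abs_le.1 (sph_abs ha hv'.1)
      have hys : y ≤ Real.sin r := by
        have h5 : Real.cos r ^ 2 ≤ (-x) ^ 2 := pow_le_pow_left₀ hcos.le (by linarith) 2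
        exact (pow_le_pow_iff_left₀ hy0 hsin.le two_ne_zero).1 (by linarith [neg_sq x])
      have hcv : ⟪c, v⟫ < 0 := by
        by_contra hneg
        push Not at hneg
        nlinarith [mul_nonneg hneg (show 0 ≤ -x by linarith), mul_nonneg hy0 (show 0 ≤ 1 + ⟪a, v⟫ by linarith)]
      have hfa : ⟪a, fold n a v⟫ ≤ 0 := by
        unfold fold
        split_ifs with hva
        · rw [inner_sphRefl, haa, real_inner_comm a v]
          rw [real_inner_comm] at hva
          have := real_inner_comm a v
          linarith
        · rw [real_inner_comm]; exact not_lt.1 hva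
      rw [hwv, inner_fold hca]
      nlinarith [mul_pos hS (neg_pos.2 hcv), mul_nonneg hC.le (neg_nonneg.2 hfa)]
    have hm : 0 < μH[(n:ℝ)] (gball n p r) := by
      have := diff_pos hn hr hp hp (by rw [sph_inner hp]; norm_num)
      exact lt_of_lt_of_le this (measure_mono Set.sdiff_subset)
    refine (pos_int_ne (gball_meas n p r) hi ?_ hm).ne' h0
    intro v hv
    exact mul_pos (g_pos_of hg_pos hz (fold_mem ha hv.1) hwz (hpos v hv).ne') (hpos v hv)

/-- For `r ∈ (0, π/4)` and `a, z, p ∈ Sⁿ` with `z·a < 0`, if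
`∫_{B_{p,r}} g(z·F_a v) π_z(F_a v) dv = 0` and `p ∉ {z, R_a(z)}`, then `R_a(z) ≠ -z` and the
midpoint `c = (z + R_a(z))/|z + R_a(z)|` belongs to the closure of `B_{p,r}`. -/
theorem statement9 (n : ℕ) (hn : 2 ≤ n)
    (g : ℝ → ℝ) (hg_cont : ContinuousOn g (Set.Icc (-1) 1))
    (hg_even : ∀ t, g (-t) = g t)
    (hg_nonneg : ∀ t ∈ Set.Icc (-1:ℝ) 1, 0 ≤ g t)
    (hg_pos : ∀ t ∈ Set.Ioo (-1:ℝ) 1, 0 < g t)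
    (r : ℝ) (hr : r ∈ Set.Ioo 0 (π / 4))
    (a z p : EuclideanSpace ℝ (Fin (n + 1)))
    (ha : a ∈ sph n) (hz : z ∈ sph n) (hp : p ∈ sph n)
    (hza : ⟪z, a⟫ < 0)
    (hcrit : (∫ v in gball n p r, g ⟪z, fold n a v⟫ • proj n z (fold n a v) ∂μH[(n:ℝ)]) = 0)
    (hpz : p ≠ z) (hpRz : p ≠ sphRefl n a z) :
    sphRefl n a z ≠ -z ∧
      ‖z + sphRefl n a z‖⁻¹ • (z + sphRefl n a z) ∈ closure (gball n p r) := by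
  have haa := sph_inner ha
  have hneg : sphRefl n a z ≠ -z := by
    intro h
    have hzz : z = ⟪z, a⟫ • a := by
      have h2 : (2:ℝ) • z = (2:ℝ) • (⟪z, a⟫ • a) := by
        have h3 : z - (2 * ⟪z, a⟫) • a = -z := h
        rw [sub_eq_iff_eq_add] at h3
        rw [smul_smul, two_smul]
        nth_rw 1 [h3]
        abel
      exact smul_right_injective _ (two_ne_zero) h2
    have ht : ⟪z, a⟫ ^ 2 = 1 := by
      have h1 := sph_inner hz
      rw [hzz] at h1
      simp only [inner_smul_left, inner_smul_right, haa, conj_trivial] at h1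
      linarith
    have ht1 : ⟪z, a⟫ = -1 := by nlinarith
    rw [ht1] at hzz
    have hza' : z = -a := by rw [hzz]; simp
    have hqa : ⟪p - ⟪p, a⟫ • a, a⟫ = 0 := by
      rw [inner_sub_left, inner_smul_left, haa]; simp
    have hqz : ⟪p - ⟪p, a⟫ • a, z⟫ = 0 := by
      rw [hza', inner_neg_right, hqa]; simp
    have hqp := span_lem hn hg_cont hg_pos hr ha hz hp hcrit hqa hqz
    have hpp : p = ⟪p, a⟫ • a := by
      have : ⟪p - ⟪p, a⟫ • a, p - ⟪p, a⟫ • a⟫ = 0 := by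
        rw [inner_sub_right, inner_smul_right, hqa, real_inner_comm, hqp]; ring
      exact sub_eq_zero.1 (inner_self_eq_zero.1 this)
    have hs : ⟪p, a⟫ ^ 2 = 1 := by
      have h1 := sph_inner hp
      rw [hpp] at h1
      simp only [inner_smul_left, inner_smul_right, haa, conj_trivial] at h1
      linarith
    rcases mul_self_eq_one_iff.1 ((sq _).symm.trans hs) with h1 | h1
    · apply hpRz
      rw [h, hza', hpp, h1]; simp
    · apply hpz
      rw [hza', hpp, h1]; simp
  refine ⟨hneg, subset_closure ?_⟩
  obtain ⟨d, hd⟩ : ∃ d, d = z + sphRefl n a z := ⟨_, rfl⟩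
  rw [← hd]
  have hd0 : d ≠ 0 := by
    intro h; apply hneg
    rw [h] at hd
    exact (neg_eq_of_add_eq_zero_right hd.symm).symm
  have hdn : 0 < ‖d‖ := norm_pos_iff.2 hd0
  obtain ⟨c, hcd⟩ : ∃ c, c = ‖d‖⁻¹ • d := ⟨_, rfl⟩
  rw [← hcd]
  have hc : c ∈ sph n := by simp [hcd, sph, norm_smul, hdn.ne']
  have hca : ⟪c, a⟫ = 0 := by
    rw [hcd, hd, inner_smul_left, inner_add_left, sphRefl_inner, haa]; simp; right; ring
  have hzc : z = (‖d‖ / 2) • c - (-⟪z, a⟫) • a := by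
    rw [hcd, smul_smul, show ‖d‖ / 2 * ‖d‖⁻¹ = 1 / 2 by field_simp, hd, sphRefl]
    module
  refine (mem_gball hr hp).2 ⟨hc, ?_⟩
  rcases le_or_gt ⟪p, a⟫ 0 with hpa | hpa
  · exact core hn hg_cont hg_pos hr ha hz hp hcrit hpz hpa hc hca (half_pos hdn) (neg_pos.2 hza) hzc
  · have hp' : sphRefl n a p ∈ sph n := (sphRefl_mem ha).2 hp
    have hcrit' : (∫ v in gball n (sphRefl n a p) r, g ⟪z, fold n a v⟫ • proj n z (fold n a v) ∂μH[(n:ℝ)]) = 0 := by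
      rw [← hcrit, ← refl_setIntegral ha _ (gball n p r)]
      have hpre : sphRefl n a ⁻¹' gball n p r = gball n (sphRefl n a p) r := by
        ext v
        rw [Set.mem_preimage, mem_gball hr hp, mem_gball hr hp', sphRefl_mem ha,
          ← sphRefl_inner_inner ha (sphRefl n a p) v, sphRefl_invol ha]
      simp only [fold_refl ha, hpre]
    have := core hn hg_cont hg_pos hr ha hz hp' hcrit' ?_ ?_ hc hca (half_pos hdn) (neg_pos.2 hza) hzc
    · rw [sphRefl_inner, real_inner_comm c a, hca] at this
      linarith
    · intro h; apply hpRz; rw [← h, sphRefl_invol ha]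
    · rw [sphRefl_inner, haa]; linarith
end
end

section
/- Let n ≥ 2, let z, w ∈ Sⁿ with z ≠ w, set a = (w − z)/|w − z| (so that w = R_a(z)), and let ρ ∈ L¹(Sⁿ). Then ∫_{Sⁿ} ρ(v) g(w·F_{−a}(v)) π_w(F_{−a}(v)) dv = R_a( ∫_{Sⁿ} ρ(v) g(z·F_a(v)) π_z(F_a(v)) dv ), where both sides are vector-valued integrals in ℝ^{n+1}. -/
open MeasureTheory Real
open scoped RealInnerProductSpace

noncomputable section

/-- For `z ≠ w` on `Sⁿ`, `a = (w - z)/|w - z|` (so `w = R_a(z)`), and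
`ρ ∈ L¹(Sⁿ)`, one has
`∫ ρ(v) g(w·F_{-a} v) π_w(F_{-a} v) dv = R_a (∫ ρ(v) g(z·F_a v) π_z(F_a v) dv)`. -/
theorem statement11 (n : ℕ) (hn : 2 ≤ n)
    (g : ℝ → ℝ) (hg_cont : ContinuousOn g (Set.Icc (-1) 1))
    (hg_even : ∀ t, g (-t) = g t)
    (hg_nonneg : ∀ t ∈ Set.Icc (-1:ℝ) 1, 0 ≤ g t)
    (hg_pos : ∀ t ∈ Set.Ioo (-1:ℝ) 1, 0 < g t)
    (z w : EuclideanSpace ℝ (Fin (n + 1))) (hz : z ∈ sph n) (hw : w ∈ sph n) (hzw : z ≠ w)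
    (a : EuclideanSpace ℝ (Fin (n + 1))) (ha : a = ‖w - z‖⁻¹ • (w - z))
    (ρ : EuclideanSpace ℝ (Fin (n + 1)) → ℝ)
    (hρ : Integrable ρ ((μH[(n:ℝ)]).restrict (sph n))) :
    (∫ v in sph n, (ρ v * g ⟪w, fold n (-a) v⟫) • proj n w (fold n (-a) v) ∂μH[(n:ℝ)]) =
      sphRefl n a
        (∫ v in sph n, (ρ v * g ⟪z, fold n a v⟫) • proj n z (fold n a v) ∂μH[(n:ℝ)]) := by
  have hz1 : ‖z‖ = 1 := by simpa [sph] using hz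
  have hw1 : ‖w‖ = 1 := by simpa [sph] using hw
  have hne : ‖w - z‖ ≠ 0 := norm_ne_zero_iff.2 (sub_ne_zero.2 hzw.symm)
  have ha1 : ‖a‖ = 1 := by
    rw [ha, norm_smul, norm_inv, norm_norm, inv_mul_cancel₀ hne]
  let L := (Submodule.span ℝ {a})ᗮ.reflection
  have hL : ∀ v, sphRefl n a v = L v := by
    intro v
    simp only [L, Submodule.reflection_orthogonal_apply, Submodule.reflection_singleton_apply]
    simp only [sphRefl, ha1, real_inner_comm a v]
    simp [two_smul, two_mul, add_smul]
  have hLL : ∀ v, L (L v) = v := fun v => Submodule.reflection_reflection _ v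
  have hLw : L z = w := by
    have h1 : L w = z := by
      have := Submodule.reflection_sub (v := w) (w := z) (by rw [hz1, hw1])
      simp only [L]
      rw [ha]
      have h2 : Submodule.span ℝ {‖w - z‖⁻¹ • (w - z)} = Submodule.span ℝ {w - z} :=
        Submodule.span_singleton_smul_eq (inv_ne_zero hne).isUnit _
      simp only [h2]
      exact this
    rw [← h1, hLL]
  have hF : ∀ v, fold n (-a) v = L (fold n a v) := by
    intro v
    have hneg : sphRefl n (-a) v = L v := by
      rw [← hL]; simp [sphRefl]
    unfold fold
    rw [hneg, hL v, inner_neg_right]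
    rcases lt_trichotomy (⟪v, a⟫) 0 with h | h | h
    · rw [if_pos (by linarith), if_neg (by linarith)]
    · rw [if_neg (by linarith), if_neg (by linarith), ← hL]
      simp [sphRefl, h]
    · rw [if_neg (by linarith), if_pos h, hLL]
  rw [hL]
  refine Eq.trans ?_ (L.toContinuousLinearEquiv.integral_comp_comm _)
  congr 1
  ext1 v
  rw [hF, ← hLw]
  simp [proj]
end
end
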